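/- arXiv:2401.09350 — 2 statements merged into one kernel-verified Lean document; each statement's English description precedes it below -/
import Mathlib

section
/- Let q ∈ R^d, X ⊂ R^d a set of m points, x* ∈ X the nearest neighbor of q in Euclidean distance, and U a uniformly random direction on S^{d-1}. Then the expected fraction of points of X whose projection onto U falls strictly between the projections of q and x* is at most (1/2)·Φ(q,X), where Φ(q,X) = (1/m)·Σ_{i=1}^m (||q - x^{(π₁)}||₂ / ||q - x^{(π_i)}||₂), and π orders X by increasing distance to q. -/
open MeasureTheory
open scoped RealInnerProductSpace

/-- Fixed planar vector: measure of bad angles. -/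
lemma bad_angle_measure (A B θ : ℝ) (hθ0 : 0 ≤ θ) (hθ : θ ≤ Real.pi / 2) :
    volume.restrict (Set.Ioc 0 Real.pi)
      {s : ℝ | (A * Real.cos s + B * Real.sin s) *
        (A * Real.cos (s - θ) + B * Real.sin (s - θ)) < 0} ≤ ENNReal.ofReal θ := by
  have hpi := Real.pi_pos
  set S : Set ℝ := {s : ℝ | (A * Real.cos s + B * Real.sin s) *
        (A * Real.cos (s - θ) + B * Real.sin (s - θ)) < 0} with hS
  have hSm : MeasurableSet S := by
    apply measurableSet_lt <;> fun_prop
  obtain ⟨r, α, hA, hB⟩ : ∃ r α : ℝ, A = r * Real.cos α ∧ B = r * Real.sin α := by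
    refine ⟨‖(⟨A, B⟩ : ℂ)‖, Complex.arg ⟨A, B⟩, ?_, ?_⟩
    · rw [Complex.norm_mul_cos_arg]
    · rw [Complex.norm_mul_sin_arg]
  have hform : ∀ s, A * Real.cos s + B * Real.sin s = r * Real.cos (s - α) := by
    intro s; rw [hA, hB, Real.cos_sub]; ring
  have hper : Function.Periodic (S.indicator (fun _ => (1 : ℝ))) Real.pi := by
    intro s
    have : s + Real.pi ∈ S ↔ s ∈ S := by
      simp only [hS, Set.mem_ofPred_eq]
      rw [show s + Real.pi - θ = (s - θ) + Real.pi by ring]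
      simp only [Real.cos_add_pi, Real.sin_add_pi]
      ring_nf
    by_cases h : s ∈ S
    · rw [Set.indicator_of_mem h, Set.indicator_of_mem (this.2 h)]
    · rw [Set.indicator_of_notMem h, Set.indicator_of_notMem (fun h' => h (this.1 h'))]
  have key := hper.intervalIntegral_add_eq 0 (α - Real.pi / 2)
  rw [intervalIntegral.integral_of_le (by linarith),
    intervalIntegral.integral_of_le (by linarith)] at key
  rw [integral_indicator_const _ hSm, integral_indicator_const _ hSm] at key
  simp only [smul_eq_mul, mul_one, zero_add] at key
  have hle : (volume.restrict (Set.Ioc (α - Real.pi / 2) (α - Real.pi / 2 + Real.pi))) S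
      ≤ ENNReal.ofReal θ := by
    rw [Measure.restrict_apply hSm]
    calc _ ≤ volume (Set.Icc (α - Real.pi / 2) (α - Real.pi / 2 + θ)) := by
          apply measure_mono
          rintro s ⟨hs, h1, h2⟩
          refine ⟨h1.le, ?_⟩
          by_contra! hc
          simp only [hS, Set.mem_ofPred_eq, hform] at hs
          have c1 : 0 ≤ Real.cos (s - α) :=
            Real.cos_nonneg_of_neg_pi_div_two_le_of_le (by linarith) (by linarith)
          have c2 : 0 ≤ Real.cos (s - θ - α) :=
            Real.cos_nonneg_of_neg_pi_div_two_le_of_le (by linarith) (by linarith)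
          have : 0 ≤ r ^ 2 * (Real.cos (s - α) * Real.cos (s - θ - α)) := by positivity
          nlinarith
      _ = ENNReal.ofReal θ := by rw [Real.volume_Icc]; congr 1; ring
  have heq : (volume.restrict (Set.Ioc 0 Real.pi)) S
      = (volume.restrict (Set.Ioc (α - Real.pi / 2) (α - Real.pi / 2 + Real.pi))) S := by
    rw [measureReal_def, measureReal_def] at key
    exact (ENNReal.toReal_eq_toReal_iff' (measure_ne_top _ _) (measure_ne_top _ _)).1 key
  rw [heq]; exact hle

lemma sign_prob
    {Ω : Type*} [MeasurableSpace Ω] (P : Measure Ω) [IsProbabilityMeasure P] {d : ℕ}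
    (U : Ω → EuclideanSpace ℝ (Fin d)) (hUmeas : Measurable U)
    (hUinv : ∀ T : EuclideanSpace ℝ (Fin d) ≃ₗᵢ[ℝ] EuclideanSpace ℝ (Fin d),
        Measure.map (fun ω => T (U ω)) P = Measure.map U P)
    (e f : EuclideanSpace ℝ (Fin d)) (he : ‖e‖ = 1) (hf : ‖f‖ = 1) (hef : ⟪e, f⟫ = 0)
    (θ : ℝ) (hθ0 : 0 ≤ θ) (hθ : θ ≤ Real.pi / 2) :
    P.real {ω | ⟪U ω, e⟫ * (⟪U ω, e⟫ * Real.cos θ + ⟪U ω, f⟫ * Real.sin θ) < 0}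
      ≤ θ / Real.pi := by
  have hpi := Real.pi_pos
  have hee : ⟪e, e⟫ = 1 := by rw [real_inner_self_eq_norm_sq, he]; norm_num
  have hff : ⟪f, f⟫ = 1 := by rw [real_inner_self_eq_norm_sq, hf]; norm_num
  have hfe : ⟪f, e⟫ = 0 := by rw [real_inner_comm]; exact hef
  set E : Set Ω := {ω | ⟪U ω, e⟫ * (⟪U ω, e⟫ * Real.cos θ + ⟪U ω, f⟫ * Real.sin θ) < 0} with hE
  set G : Set (EuclideanSpace ℝ (Fin d)) :=
    {x | ⟪x, e⟫ * (⟪x, e⟫ * Real.cos θ + ⟪x, f⟫ * Real.sin θ) < 0} with hG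
  have hGm : MeasurableSet G := by
    apply measurableSet_lt <;> fun_prop
  set S : Set (ℝ × Ω) := {p | (⟪U p.2, e⟫ * Real.cos p.1 + ⟪U p.2, f⟫ * Real.sin p.1) *
        (⟪U p.2, e⟫ * Real.cos (p.1 - θ) + ⟪U p.2, f⟫ * Real.sin (p.1 - θ)) < 0} with hS
  have hSm : MeasurableSet S := by
    apply measurableSet_lt <;> fun_prop
  have hfib : ∀ s : ℝ, P (Prod.mk s ⁻¹' S) = P E := by
    intro s
    set n : EuclideanSpace ℝ (Fin d) := Real.cos (s / 2) • e + Real.sin (s / 2) • f with hn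
    have hnn : ‖n‖ ^ 2 = 1 := by
      rw [← real_inner_self_eq_norm_sq]
      simp only [hn, inner_add_left, inner_add_right, real_inner_smul_left, real_inner_smul_right,
        hee, hff, hef, hfe]
      have := Real.cos_sq_add_sin_sq (s / 2)
      linarith
    have hT := hUinv (Submodule.reflection (Submodule.span ℝ {n}))
    have h1 := congrArg (fun μ => μ G) hT
    beta_reduce at h1
    rw [Measure.map_apply (by fun_prop) hGm, Measure.map_apply hUmeas hGm] at h1
    have h2 : U ⁻¹' G = E := rfl
    rw [← h2, ← h1]
    congr 1
    ext ω
    have hR : ∀ x, Submodule.reflection (Submodule.span ℝ {n}) x = (2 * ⟪n, x⟫) • n - x := by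
      intro x
      rw [Submodule.reflection_singleton_apply]
      simp [hnn, mul_smul, two_smul]
    have c2 : Real.cos s = 2 * Real.cos (s / 2) ^ 2 - 1 := by
      rw [← Real.cos_two_mul]; congr 1; ring
    have s2 : Real.sin s = 2 * Real.sin (s / 2) * Real.cos (s / 2) := by
      rw [← Real.sin_two_mul]; congr 1; ring
    have hcs := Real.sin_sq_add_cos_sq (s / 2)
    have hxe : ∀ x, ⟪Submodule.reflection (Submodule.span ℝ {n}) x, e⟫
        = ⟪x, e⟫ * Real.cos s + ⟪x, f⟫ * Real.sin s := by
      intro x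
      rw [hR, c2, s2]
      simp only [hn, inner_add_left, inner_sub_left, real_inner_smul_left, inner_add_right, real_inner_smul_right,
        hee, hfe, real_inner_comm x]
      ring
    have hxf : ∀ x, ⟪Submodule.reflection (Submodule.span ℝ {n}) x, f⟫
        = ⟪x, e⟫ * Real.sin s - ⟪x, f⟫ * Real.cos s := by
      intro x
      rw [hR, c2, s2]
      simp only [hn, inner_add_left, inner_sub_left, real_inner_smul_left, inner_add_right, real_inner_smul_right,
        hff, hef, real_inner_comm x]
      linear_combination 2 * ⟪x, f⟫ * hcs
    simp only [hS, hG, Set.mem_preimage, Set.mem_ofPred_eq, hxe, hxf, Real.cos_sub, Real.sin_sub]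
    ring_nf
  have hA := Measure.prod_apply (μ := volume.restrict (Set.Ioc 0 Real.pi)) (ν := P) hSm
  have hB := Measure.prod_apply_symm (μ := volume.restrict (Set.Ioc 0 Real.pi)) (ν := P) hSm
  simp only [hfib, lintegral_const, Measure.restrict_apply_univ, Real.volume_Ioc, sub_zero] at hA
  have hC : (∫⁻ y, (volume.restrict (Set.Ioc 0 Real.pi)) ((fun x => (x, y)) ⁻¹' S) ∂P)
      ≤ ∫⁻ y, ENNReal.ofReal θ ∂P :=
    lintegral_mono fun y => bad_angle_measure ⟪U y, e⟫ ⟪U y, f⟫ θ hθ0 hθ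
  rw [← hB, hA] at hC
  simp only [lintegral_const, measure_univ, mul_one] at hC
  have hD := ENNReal.toReal_mono ENNReal.ofReal_ne_top hC
  rw [ENNReal.toReal_mul, ENNReal.toReal_ofReal hpi.le, ENNReal.toReal_ofReal hθ0] at hD
  rw [le_div_iff₀ hpi]
  exact hD

lemma collision
    {Ω : Type*} [MeasurableSpace Ω] (P : Measure Ω) [IsProbabilityMeasure P] {d : ℕ}
    (U : Ω → EuclideanSpace ℝ (Fin d)) (hUmeas : Measurable U)
    (hUinv : ∀ T : EuclideanSpace ℝ (Fin d) ≃ₗᵢ[ℝ] EuclideanSpace ℝ (Fin d),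
        Measure.map (fun ω => T (U ω)) P = Measure.map U P)
    (a b : EuclideanSpace ℝ (Fin d)) (hab : ‖a‖ ≤ ‖b‖) :
    P.real {ω | ⟪U ω, b⟫ * ⟪U ω, b - a⟫ < 0} ≤ 1 / 2 * (‖a‖ / ‖b‖) := by
  have hpi := Real.pi_pos
  have hnn : 0 ≤ 1 / 2 * (‖a‖ / ‖b‖) := by positivity
  by_cases hb : b = 0
  · simp [hb]
  have hB : 0 < ‖b‖ := norm_pos_iff.2 hb
  set β := ‖b‖ with hβ
  set e : EuclideanSpace ℝ (Fin d) := β⁻¹ • b with he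
  have hbe : b = β • e := by rw [he, smul_smul, mul_inv_cancel₀ hB.ne', one_smul]
  have hen : ‖e‖ = 1 := by
    rw [he, norm_smul, norm_inv, Real.norm_of_nonneg hB.le, ← hβ, inv_mul_cancel₀ hB.ne']
  have hee : ⟪e, e⟫ = 1 := by rw [real_inner_self_eq_norm_sq, hen]; norm_num
  set a1 := ⟪e, a⟫ with ha1
  set w := a1 • e - a with hw
  have hew : ⟪e, w⟫ = 0 := by
    rw [hw, inner_sub_right, real_inner_smul_right, hee]; simp [ha1]
  have hawe : a = a1 • e - w := by rw [hw]; abel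
  have ha2 : ‖a‖ ^ 2 = a1 ^ 2 + ‖w‖ ^ 2 := by
    rw [← real_inner_self_eq_norm_sq, ← real_inner_self_eq_norm_sq, hawe]
    simp only [inner_sub_left, inner_sub_right, real_inner_smul_left, real_inner_smul_right,
      hee, hew, real_inner_comm e w]
    ring
  have ha1le : a1 ≤ ‖a‖ := by
    have := real_inner_le_norm e a
    rwa [hen, one_mul] at this
  have hba : b - a = (β - a1) • e + w := by rw [hw, sub_smul, ← hbe]; abel
  have hUb : ∀ x, ⟪x, b⟫ = β * ⟪x, e⟫ := by
    intro x
    rw [← real_inner_smul_right x e β, ← hbe]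
  by_cases hw0 : w = 0
  · have : {ω | ⟪U ω, b⟫ * ⟪U ω, b - a⟫ < 0} = ∅ := by
      ext ω
      simp only [Set.mem_ofPred_eq, Set.mem_empty_iff_false, iff_false, not_lt]
      rw [hba, hw0, add_zero, hUb, real_inner_smul_right (U ω) e (β - a1)]
      have : 0 ≤ β * (β - a1) * ⟪U ω, e⟫ ^ 2 :=
        mul_nonneg (mul_nonneg hB.le (by linarith)) (sq_nonneg _)
      linarith
    rw [this]; simpa using hnn
  set γ := ‖w‖ with hγ
  have hγ0 : 0 < γ := norm_pos_iff.2 hw0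
  have hlt : a1 < β := by nlinarith [norm_nonneg a]
  set f : EuclideanSpace ℝ (Fin d) := γ⁻¹ • w with hf
  have hwf : w = γ • f := by rw [hf, smul_smul, mul_inv_cancel₀ hγ0.ne', one_smul]
  have hfn : ‖f‖ = 1 := by
    rw [hf, norm_smul, norm_inv, Real.norm_of_nonneg hγ0.le, ← hγ, inv_mul_cancel₀ hγ0.ne']
  have hef : ⟪e, f⟫ = 0 := by rw [hf, real_inner_smul_right, hew, mul_zero]
  set z : ℂ := ⟨β - a1, γ⟩ with hz
  set ρ := ‖z‖ with hρ
  have hz0 : z ≠ 0 := fun h => hγ0.ne' (congrArg Complex.im h)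
  have hρ0 : 0 < ρ := norm_pos_iff.2 hz0
  set θ := Complex.arg z with hθ
  have hcos : ρ * Real.cos θ = β - a1 := Complex.norm_mul_cos_arg z
  have hsin : ρ * Real.sin θ = γ := Complex.norm_mul_sin_arg z
  have hθ0 : 0 ≤ θ := Complex.arg_nonneg_iff.2 hγ0.le
  have hθ2 : θ ≤ Real.pi / 2 := by
    rw [hθ, Complex.arg_le_pi_div_two_iff]; left; show 0 ≤ β - a1; linarith
  have hprob := sign_prob P U hUmeas hUinv e f hen hfn hef θ hθ0 hθ2
  have hset : {ω | ⟪U ω, b⟫ * ⟪U ω, b - a⟫ < 0} =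
      {ω | ⟪U ω, e⟫ * (⟪U ω, e⟫ * Real.cos θ + ⟪U ω, f⟫ * Real.sin θ) < 0} := by
    ext ω
    simp only [Set.mem_ofPred_eq]
    have : ⟪U ω, b⟫ * ⟪U ω, b - a⟫ = (β * ρ) *
        (⟪U ω, e⟫ * (⟪U ω, e⟫ * Real.cos θ + ⟪U ω, f⟫ * Real.sin θ)) := by
      have h1 : ⟪U ω, w⟫ = γ * ⟪U ω, f⟫ := by
        rw [← real_inner_smul_right (U ω) f γ, ← hwf]
      rw [hba, inner_add_right, h1, hUb, real_inner_smul_right (U ω) e (β - a1)]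
      linear_combination (-β * ⟪U ω, e⟫ ^ 2) * hcos - β * ⟪U ω, e⟫ * ⟪U ω, f⟫ * hsin
    rw [this, mul_neg_iff]
    have hp : 0 < β * ρ := by positivity
    constructor
    · rintro (h | h)
      · exact h.2
      · linarith [h.1]
    · intro h; exact Or.inl ⟨hp, h⟩
  rw [hset]
  refine hprob.trans ?_
  have hj := Real.mul_le_sin hθ0 hθ2
  have hsl : Real.sin θ ≤ ‖a‖ / β := by
    rw [le_div_iff₀ hB]
    have hs0 : 0 ≤ Real.sin θ := Real.sin_nonneg_of_nonneg_of_le_pi hθ0 (by linarith)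
    apply le_of_mul_le_mul_left _ hρ0
    have hρ2 : ρ ^ 2 = (β - a1) ^ 2 + γ ^ 2 := by
      rw [← hcos, ← hsin]
      linear_combination (-ρ ^ 2) * Real.sin_sq_add_cos_sq θ
    have : ρ * (Real.sin θ * β) = γ * β := by rw [← hsin]; ring
    rw [this]
    apply le_of_sq_le_sq _ (by positivity)
    rw [mul_pow ρ, hρ2, ha2]
    nlinarith [sq_nonneg (a1 * (β - a1) - γ ^ 2)]
  have : θ / Real.pi = 1 / 2 * (2 / Real.pi * θ) := by field_simp
  rw [this]
  linarith

/-- The expected fraction of points whose projection onto a uniformly random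
direction falls strictly between the projections of the query `q` and its
nearest neighbor `x* = X i₀` is at most `Φ(q,X)/2`, where
`Φ(q,X) = (1/m) ∑ᵢ ‖q - x*‖/‖q - Xᵢ‖`. -/
theorem stmt9
    {Ω : Type*} [MeasurableSpace Ω] (P : Measure Ω) [IsProbabilityMeasure P]
    (d m : ℕ) (hm : 0 < m)
    (q : EuclideanSpace ℝ (Fin d)) (X : Fin m → EuclideanSpace ℝ (Fin d))
    (i₀ : Fin m) (hi₀ : ∀ i, ‖q - X i₀‖ ≤ ‖q - X i‖)
    (U : Ω → EuclideanSpace ℝ (Fin d)) (hUmeas : Measurable U)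
    (hUnorm : ∀ ω, ‖U ω‖ = 1)
    (hUinv : ∀ T : EuclideanSpace ℝ (Fin d) ≃ₗᵢ[ℝ] EuclideanSpace ℝ (Fin d),
        Measure.map (fun ω => T (U ω)) P = Measure.map U P) :
    (∫ ω, (Nat.card {i : Fin m //
        (⟪U ω, q⟫ < ⟪U ω, X i⟫ ∧ ⟪U ω, X i⟫ < ⟪U ω, X i₀⟫) ∨
        (⟪U ω, X i₀⟫ < ⟪U ω, X i⟫ ∧ ⟪U ω, X i⟫ < ⟪U ω, q⟫)} : ℝ) / m ∂P)
      ≤ (1 / 2) * ((1 / m) * ∑ i : Fin m, ‖q - X i₀‖ / ‖q - X i‖) := by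
  classical
  set E : Fin m → Set Ω := fun i =>
    {ω | ⟪U ω, q - X i⟫ * ⟪U ω, (q - X i) - (q - X i₀)⟫ < 0} with hE
  have hEm : ∀ i, MeasurableSet (E i) := by
    intro i; apply measurableSet_lt <;> fun_prop
  have hcard : ∀ ω, (Nat.card {i : Fin m //
        (⟪U ω, q⟫ < ⟪U ω, X i⟫ ∧ ⟪U ω, X i⟫ < ⟪U ω, X i₀⟫) ∨
        (⟪U ω, X i₀⟫ < ⟪U ω, X i⟫ ∧ ⟪U ω, X i⟫ < ⟪U ω, q⟫)} : ℝ)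
        = ∑ i, (E i).indicator (fun _ => (1 : ℝ)) ω := by
    intro ω
    rw [Nat.card_eq_fintype_card, Fintype.card_subtype, Finset.card_filter]
    push_cast
    refine Finset.sum_congr rfl fun i _ => ?_
    rw [Set.indicator_apply]
    refine if_congr ?_ rfl rfl
    simp only [hE, Set.mem_ofPred_eq, inner_sub_right, mul_neg_iff]
    constructor
    · rintro (⟨h1, h2⟩ | ⟨h1, h2⟩)
      · right; constructor <;> linarith
      · left; constructor <;> linarith
    · rintro (⟨h1, h2⟩ | ⟨h1, h2⟩)
      · right; constructor <;> linarith
      · left; constructor <;> linarith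
  simp only [hcard]
  rw [integral_div, integral_finsetSum _ fun i _ =>
    (integrable_const (1 : ℝ)).indicator (hEm i)]
  have hsum : ∑ i, ∫ ω, (E i).indicator (fun _ => (1 : ℝ)) ω ∂P
      ≤ ∑ i, 1 / 2 * (‖q - X i₀‖ / ‖q - X i‖) := by
    refine Finset.sum_le_sum fun i _ => ?_
    rw [integral_indicator_const _ (hEm i), smul_eq_mul, mul_one]
    exact collision P U hUmeas hUinv (q - X i₀) (q - X i) (hi₀ i)
  rw [← Finset.mul_sum] at hsum
  have hm' : (0 : ℝ) < m := by exact_mod_cast hm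
  rw [div_le_iff₀ hm']
  refine hsum.trans (le_of_eq ?_)
  field_simp
end

section
/- Under the assumptions of the previous statement, for any α ∈ (0,1) and any s-element subset S of X containing x*, the probability that at least an α fraction of the projections of S fall between the projections of q and x* is at most Φ_s(q,X)/(2α), where Φ_s(q,X) = (1/s)·Σ_{i=1}^s ||q - x^{(π₁)}||₂ / ||q - x^{(π_i)}||₂ over the s closest points to q. -/
open MeasureTheory
open scoped RealInnerProductSpace

lemma aux_vol (ψ θ : ℝ) (hθ : 0 ≤ θ) :
    volume ({β : ℝ | Real.cos (β - ψ) * Real.cos (β - ψ - θ) < 0} ∩ Set.Ioc 0 (0 + Real.pi))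
      ≤ ENNReal.ofReal θ := by
  have hmeas : MeasurableSet {β : ℝ | Real.cos (β - ψ) * Real.cos (β - ψ - θ) < 0} :=
    measurableSet_lt (by fun_prop) (by fun_prop)
  rw [(isAddFundamentalDomain_Ioc Real.pi_pos 0).measure_set_eq (μ := volume)
    (isAddFundamentalDomain_Ioc Real.pi_pos (ψ - Real.pi / 2)) hmeas]
  · calc _ ≤ volume (Set.Icc (ψ - Real.pi / 2) (ψ - Real.pi / 2 + θ)) := by
          apply measure_mono
          rintro β ⟨h1, h2, h3⟩
          simp only [Set.mem_ofPred_eq] at h1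
          refine ⟨h2.le, ?_⟩
          by_contra hcon
          push Not at hcon
          have c1 : 0 ≤ Real.cos (β - ψ) :=
            Real.cos_nonneg_of_neg_pi_div_two_le_of_le (by linarith) (by linarith)
          have c2 : 0 ≤ Real.cos (β - ψ - θ) :=
            Real.cos_nonneg_of_neg_pi_div_two_le_of_le (by linarith) (by linarith)
          nlinarith [mul_nonneg c1 c2]
      _ = _ := by rw [Real.volume_Icc]; congr 1; ring
  · rintro ⟨g, hg⟩
    obtain ⟨k, rfl⟩ := AddSubgroup.mem_zmultiples_iff.1 hg
    ext β
    simp only [Set.mem_preimage, Set.mem_ofPred_eq, AddSubgroup.mk_vadd, vadd_eq_add, zsmul_eq_mul]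
    have e1 : (k : ℝ) * Real.pi + β - ψ = (β - ψ) + k * Real.pi := by ring
    have e2 : (β - ψ) + k * Real.pi - θ = (β - ψ - θ) + k * Real.pi := by ring
    rw [e1, e2, Real.cos_add_int_mul_pi, Real.cos_add_int_mul_pi]
    have : ((-1 : ℝ) ^ k) * ((-1 : ℝ) ^ k) = 1 := by
      rw [← mul_zpow]; simp
    rw [mul_mul_mul_comm, this, one_mul]

lemma aux_refl {E : Type*} [NormedAddCommGroup E] [InnerProductSpace ℝ E]
    (e₁ e₂ : E) (h1 : ‖e₁‖ = 1) (h2 : ‖e₂‖ = 1) (h12 : ⟪e₁, e₂⟫ = 0) (β : ℝ) :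
    ∃ R : E ≃ₗᵢ[ℝ] E, ∀ (t : ℝ) (u : E),
      ⟪R u, Real.cos t • e₁ + Real.sin t • e₂⟫ =
        -(⟪u, e₁⟫ * Real.cos (β - t) + ⟪u, e₂⟫ * Real.sin (β - t)) := by
  set n : E := Real.cos (β / 2) • e₁ + Real.sin (β / 2) • e₂ with hn
  have h21 : ⟪e₂, e₁⟫ = 0 := by rw [real_inner_comm]; exact h12
  have i1 : ⟪e₁, e₁⟫ = 1 := by rw [real_inner_self_eq_norm_sq, h1]; norm_num
  have i2 : ⟪e₂, e₂⟫ = 1 := by rw [real_inner_self_eq_norm_sq, h2]; norm_num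
  have hnn : ‖n‖ = 1 := by
    have : ‖n‖ ^ 2 = 1 := by
      rw [← real_inner_self_eq_norm_sq, hn]
      simp only [inner_add_left, inner_add_right, real_inner_smul_left, real_inner_smul_right,
        h12, h21, i1, i2]
      nlinarith [Real.sin_sq_add_cos_sq (β / 2)]
    nlinarith [norm_nonneg n]
  refine ⟨(ℝ ∙ n)ᗮ.reflection, fun t u => ?_⟩
  rw [Submodule.reflection_orthogonal_apply, Submodule.reflection_singleton_apply, hnn, hn, two_nsmul]
  have eb : β = β / 2 + β / 2 := by ring
  have ec : Real.cos (β - t) = (Real.cos (β/2)^2 - Real.sin (β/2)^2) * Real.cos t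
      + 2 * Real.sin (β/2) * Real.cos (β/2) * Real.sin t := by
    rw [Real.cos_sub]; conv_lhs => rw [eb, Real.cos_add, Real.sin_add]
    ring
  have es : Real.sin (β - t) = 2 * Real.sin (β/2) * Real.cos (β/2) * Real.cos t
      - (Real.cos (β/2)^2 - Real.sin (β/2)^2) * Real.sin t := by
    rw [Real.sin_sub]; conv_lhs => rw [eb, Real.cos_add, Real.sin_add]
    ring
  rw [ec, es]
  simp only [inner_add_left, inner_add_right, real_inner_smul_left, real_inner_smul_right,
    inner_sub_left, inner_neg_left, h12, h21, i1, i2, real_inner_comm u e₁, real_inner_comm u e₂, RCLike.ofReal_real_eq_id, id]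
  have hs := Real.sin_sq_add_cos_sq (β / 2)
  simp only [one_pow, div_one]
  linear_combination (⟪u, e₁⟫ * Real.cos t + ⟪u, e₂⟫ * Real.sin t) * (-hs)

lemma aux_GW {Ω : Type*} [MeasurableSpace Ω] (P : Measure Ω) [IsProbabilityMeasure P]
    {d : ℕ} (U : Ω → EuclideanSpace ℝ (Fin d)) (hUmeas : Measurable U)
    (hUinv : ∀ T : EuclideanSpace ℝ (Fin d) ≃ₗᵢ[ℝ] EuclideanSpace ℝ (Fin d),
        Measure.map (fun ω => T (U ω)) P = Measure.map U P)
    (e₁ e₂ : EuclideanSpace ℝ (Fin d)) (h1 : ‖e₁‖ = 1) (h2 : ‖e₂‖ = 1) (h12 : ⟪e₁, e₂⟫ = 0)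
    (θ : ℝ) (hθ : 0 ≤ θ) :
    ENNReal.ofReal Real.pi *
      P {ω | ⟪U ω, e₁⟫ * ⟪U ω, Real.cos θ • e₁ + Real.sin θ • e₂⟫ < 0} ≤ ENNReal.ofReal θ := by
  set A : Set (ℝ × Ω) := {p | (⟪U p.2, e₁⟫ * Real.cos p.1 + ⟪U p.2, e₂⟫ * Real.sin p.1) *
    (⟪U p.2, e₁⟫ * Real.cos (p.1 - θ) + ⟪U p.2, e₂⟫ * Real.sin (p.1 - θ)) < 0} with hA
  have hAm : MeasurableSet A := measurableSet_lt (by fun_prop) (by fun_prop)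
  have key : ∀ β : ℝ, P (Prod.mk β ⁻¹' A) =
      P {ω | ⟪U ω, e₁⟫ * ⟪U ω, Real.cos θ • e₁ + Real.sin θ • e₂⟫ < 0} := by
    intro β
    obtain ⟨R, hR⟩ := aux_refl e₁ e₂ h1 h2 h12 β
    set B : Set (EuclideanSpace ℝ (Fin d)) :=
      {u | ⟪u, e₁⟫ * ⟪u, Real.cos θ • e₁ + Real.sin θ • e₂⟫ < 0} with hB
    have hBm : MeasurableSet B := measurableSet_lt (by fun_prop) (by fun_prop)
    have := congrArg (fun μ => μ B) (hUinv R)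
    rw [Measure.map_apply (by fun_prop) hBm, Measure.map_apply hUmeas hBm] at this
    rw [show {ω | ⟪U ω, e₁⟫ * ⟪U ω, Real.cos θ • e₁ + Real.sin θ • e₂⟫ < 0} = U ⁻¹' B from rfl,
      ← this]
    congr 1
    ext ω
    have r0 := hR 0 (U ω)
    have r1 := hR θ (U ω)
    simp only [Real.cos_zero, Real.sin_zero, one_smul, zero_smul, add_zero, sub_zero] at r0
    simp only [Set.mem_preimage, hA, hB, Set.mem_ofPred_eq, r0, r1, neg_mul_neg]
  have f1 : ((volume.restrict (Set.Ioc 0 (0 + Real.pi))).prod P) A = ENNReal.ofReal Real.pi *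
      P {ω | ⟪U ω, e₁⟫ * ⟪U ω, Real.cos θ • e₁ + Real.sin θ • e₂⟫ < 0} := by
    rw [Measure.prod_apply hAm]
    simp only [key]
    rw [lintegral_const, mul_comm]
    simp
  rw [← f1, Measure.prod_apply_symm hAm]
  calc _ ≤ ∫⁻ _, ENNReal.ofReal θ ∂P := by
        apply lintegral_mono
        intro ω
        simp only
        rw [Measure.restrict_apply (hAm.preimage (by fun_prop))]
        refine le_trans (measure_mono ?_) (aux_vol (Complex.arg ⟨⟪U ω, e₁⟫, ⟪U ω, e₂⟫⟩) θ hθ)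
        apply Set.inter_subset_inter_left
        intro β hβ
        set z : ℂ := ⟨⟪U ω, e₁⟫, ⟪U ω, e₂⟫⟩ with hz
        have zr : ⟪U ω, e₁⟫ = ‖z‖ * Real.cos z.arg := (Complex.norm_mul_cos_arg z).symm
        have zi : ⟪U ω, e₂⟫ = ‖z‖ * Real.sin z.arg := (Complex.norm_mul_sin_arg z).symm
        simp only [hA, Set.mem_preimage, Set.mem_ofPred_eq] at hβ ⊢
        have a1 : ∀ t, ⟪U ω, e₁⟫ * Real.cos t + ⟪U ω, e₂⟫ * Real.sin t
            = ‖z‖ * Real.cos (t - z.arg) := by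
          intro t
          rw [zr, zi, Real.cos_sub]; ring
        rw [a1, a1, show β - θ - z.arg = β - z.arg - θ by ring] at hβ
        by_contra hc
        push Not at hc
        have := mul_nonneg (mul_self_nonneg ‖z‖) hc
        nlinarith
    _ = _ := by simp

lemma aux_pair {Ω : Type*} [MeasurableSpace Ω] (P : Measure Ω) [IsProbabilityMeasure P]
    {d : ℕ} (U : Ω → EuclideanSpace ℝ (Fin d)) (hUmeas : Measurable U)
    (hUinv : ∀ T : EuclideanSpace ℝ (Fin d) ≃ₗᵢ[ℝ] EuclideanSpace ℝ (Fin d),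
        Measure.map (fun ω => T (U ω)) P = Measure.map U P)
    (x y : EuclideanSpace ℝ (Fin d)) (hx : x ≠ 0) (hy : y ≠ 0)
    (hxy : 0 ≤ ⟪x, y⟫) :
    Real.pi * P.real {ω | ⟪U ω, x⟫ * ⟪U ω, y⟫ < 0} ≤ InnerProductGeometry.angle x y := by
  set θ := InnerProductGeometry.angle x y with hθ
  have hθ0 : 0 ≤ θ := InnerProductGeometry.angle_nonneg x y
  have hθ1 : θ ≤ Real.pi / 2 := Real.arccos_le_pi_div_two.2 (by positivity)
  have hnx : 0 < ‖x‖ := norm_pos_iff.2 hx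
  have hny : 0 < ‖y‖ := norm_pos_iff.2 hy
  rcases hθ0.eq_or_lt with h0 | hpos
  · obtain ⟨_, r, hr, rfl⟩ := InnerProductGeometry.angle_eq_zero_iff.1 (hθ.symm.trans h0.symm)
    have : {ω | ⟪U ω, x⟫ * ⟪U ω, r • x⟫ < 0} = ∅ := by
      ext ω
      simp only [Set.mem_ofPred_eq, Set.mem_empty_iff_false, iff_false, not_lt, real_inner_smul_right]
      nlinarith [mul_nonneg hr.le (mul_self_nonneg ⟪U ω, x⟫)]
    rw [this]; simp [hθ0]
  have hsin : 0 < Real.sin θ := Real.sin_pos_of_pos_of_lt_pi hpos (by linarith [Real.pi_pos])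
  set e₁ := (‖x‖)⁻¹ • x with he1
  set f := (‖y‖)⁻¹ • y with hf
  set e₂ := (Real.sin θ)⁻¹ • (f - Real.cos θ • e₁) with he2
  have n1 : ‖e₁‖ = 1 := by rw [he1, norm_smul, norm_inv, norm_norm, inv_mul_cancel₀ hnx.ne']
  have nf : ‖f‖ = 1 := by rw [hf, norm_smul, norm_inv, norm_norm, inv_mul_cancel₀ hny.ne']
  have i1 : ⟪e₁, e₁⟫ = 1 := by rw [real_inner_self_eq_norm_sq, n1]; norm_num
  have iff' : ⟪f, f⟫ = 1 := by rw [real_inner_self_eq_norm_sq, nf]; norm_num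
  have ief : ⟪e₁, f⟫ = Real.cos θ := by
    rw [he1, hf, real_inner_smul_left, real_inner_smul_right, hθ, InnerProductGeometry.cos_angle]
    field_simp
  have ife : ⟪f, e₁⟫ = Real.cos θ := by rw [real_inner_comm]; exact ief
  have h12 : ⟪e₁, e₂⟫ = 0 := by
    rw [he2, real_inner_smul_right, inner_sub_right, real_inner_smul_right e₁ e₁, i1, ief]; ring
  have n2 : ‖e₂‖ = 1 := by
    have : ‖e₂‖ ^ 2 = 1 := by
      rw [← real_inner_self_eq_norm_sq, he2]
      simp only [inner_sub_left, inner_sub_right, real_inner_smul_left, real_inner_smul_right,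
        ief, ife, i1, iff']
      field_simp
      nlinarith [Real.sin_sq_add_cos_sq θ]
    nlinarith [norm_nonneg e₂]
  have hfe : Real.cos θ • e₁ + Real.sin θ • e₂ = f := by
    rw [he2, smul_inv_smul₀ hsin.ne']; abel
  have main := aux_GW P U hUmeas hUinv e₁ e₂ n1 n2 h12 θ hθ0
  rw [hfe] at main
  have hset : {ω | ⟪U ω, e₁⟫ * ⟪U ω, f⟫ < 0} = {ω | ⟪U ω, x⟫ * ⟪U ω, y⟫ < 0} := by
    ext ω
    simp only [Set.mem_ofPred_eq, he1, hf, real_inner_smul_right]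
    rw [mul_mul_mul_comm]
    have : 0 < ‖x‖⁻¹ * ‖y‖⁻¹ := by positivity
    constructor
    · intro h; by_contra hc; push Not at hc; nlinarith [mul_nonneg this.le hc]
    · intro h; exact mul_neg_of_pos_of_neg this h
  rw [hset] at main
  have := ENNReal.toReal_mono (by simp) main
  rwa [ENNReal.toReal_mul, ENNReal.toReal_ofReal Real.pi_pos.le, ENNReal.toReal_ofReal hθ0] at this

lemma aux_point {Ω : Type*} [MeasurableSpace Ω] (P : Measure Ω) [IsProbabilityMeasure P]
    {d : ℕ} (U : Ω → EuclideanSpace ℝ (Fin d)) (hUmeas : Measurable U)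
    (hUinv : ∀ T : EuclideanSpace ℝ (Fin d) ≃ₗᵢ[ℝ] EuclideanSpace ℝ (Fin d),
        Measure.map (fun ω => T (U ω)) P = Measure.map U P)
    (w y : EuclideanSpace ℝ (Fin d)) (hw : ‖w - y‖ ≤ ‖w‖) :
    P.real {ω | ⟪U ω, w⟫ * ⟪U ω, y⟫ < 0} ≤ ‖w - y‖ / ‖w‖ / 2 := by
  by_cases hw0 : w = 0
  · simp [hw0]
  by_cases hy0 : y = 0
  · simp only [hy0, inner_zero_right, mul_zero, lt_self_iff_false, Set.ofPred_false,
      measureReal_empty]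
    positivity
  have hnw : 0 < ‖w‖ := norm_pos_iff.2 hw0
  have hny : 0 < ‖y‖ := norm_pos_iff.2 hy0
  have hsq := norm_sub_sq_real w y
  have hip : 0 ≤ ⟪w, y⟫ := by nlinarith [norm_nonneg (w - y), sq_nonneg ‖y‖]
  have main := aux_pair P U hUmeas hUinv w y hw0 hy0 hip
  set θ := InnerProductGeometry.angle w y with hθ
  have hθ0 : 0 ≤ θ := InnerProductGeometry.angle_nonneg w y
  have hθ1 : θ ≤ Real.pi / 2 :=
    Real.arccos_le_pi_div_two.2 (by positivity)
  have hs := Real.mul_le_sin hθ0 hθ1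
  have hsin : Real.sin θ * ‖w‖ ≤ ‖w - y‖ := by
    have e := InnerProductGeometry.sin_angle_mul_norm_mul_norm w y
    have : Real.sin θ * (‖w‖ * ‖y‖) ≤ ‖w - y‖ * ‖y‖ := by
      rw [hθ, e]
      apply Real.sqrt_le_iff.2 ⟨by positivity, ?_⟩
      rw [real_inner_self_eq_norm_sq, real_inner_self_eq_norm_sq, mul_pow, hsq]
      nlinarith [sq_nonneg (‖y‖ ^ 2 - ⟪w, y⟫)]
    rw [← mul_assoc] at this
    exact le_of_mul_le_mul_right this hny
  have hpi := Real.pi_pos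
  rw [div_div, le_div_iff₀ (by positivity)]
  set p := P.real {ω | ⟪U ω, w⟫ * ⟪U ω, y⟫ < 0}
  have h2 : 2 * p ≤ Real.sin θ := by
    refine le_trans ?_ hs
    rw [div_mul_eq_mul_div, le_div_iff₀ hpi]; linarith
  nlinarith

lemma aux_sum {m : ℕ} (S T : Finset (Fin m)) (h : S.card = T.card) (r : Fin m → ℝ)
    (hr : ∀ i ∈ T, ∀ j ∉ T, r j ≤ r i) : ∑ i ∈ S, r i ≤ ∑ i ∈ T, r i := by
  have hc : (S \ T).card = (T \ S).card := Finset.card_sdiff_comm h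
  rw [← Finset.sum_inter_add_sum_sdiff S T r, ← Finset.sum_inter_add_sum_sdiff T S r,
    Finset.inter_comm T S]
  apply add_le_add le_rfl
  rcases (T \ S).eq_empty_or_nonempty with he | hne
  · rw [he, Finset.card_empty, Finset.card_eq_zero] at hc
    rw [hc, he]
  · obtain ⟨i, hi, hmin⟩ := Finset.exists_min_image (T \ S) r hne
    calc _ ≤ (S \ T).card • r i := Finset.sum_le_card_nsmul _ _ _ fun j hj =>
            hr i (Finset.mem_sdiff.1 hi).1 j (Finset.mem_sdiff.1 hj).2
      _ = (T \ S).card • r i := by rw [hc]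
      _ ≤ _ := Finset.card_nsmul_le_sum _ _ _ hmin

/-- For any `α ∈ (0,1)` and any `s`-element subset `S` of the data containing the
nearest neighbor `x* = X i₀`, the probability that at least an `α` fraction of
the projections of `S` onto a uniformly random direction fall between the
projections of `q` and `x*` is at most `Φ_s(q,X)/(2α)`, where `Φ_s` averages
the distance ratios over the `s` points closest to `q`. -/
theorem stmt10
    {Ω : Type*} [MeasurableSpace Ω] (P : Measure Ω) [IsProbabilityMeasure P]
    (d m : ℕ) (hm : 0 < m)
    (q : EuclideanSpace ℝ (Fin d)) (X : Fin m → EuclideanSpace ℝ (Fin d))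
    (i₀ : Fin m) (hi₀ : ∀ i, ‖q - X i₀‖ ≤ ‖q - X i‖)
    (U : Ω → EuclideanSpace ℝ (Fin d)) (hUmeas : Measurable U)
    (hUnorm : ∀ ω, ‖U ω‖ = 1)
    (hUinv : ∀ T : EuclideanSpace ℝ (Fin d) ≃ₗᵢ[ℝ] EuclideanSpace ℝ (Fin d),
        Measure.map (fun ω => T (U ω)) P = Measure.map U P)
    (a : ℝ) (ha : a ∈ Set.Ioo (0 : ℝ) 1)
    (s : ℕ) (S : Finset (Fin m)) (hScard : S.card = s) (hi₀S : i₀ ∈ S)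
    (T : Finset (Fin m)) (hTcard : T.card = s)
    (hTclosest : ∀ i ∈ T, ∀ j ∉ T, ‖q - X i‖ ≤ ‖q - X j‖) :
    (P {ω | a * s ≤ (Nat.card {i : Fin m // i ∈ S ∧
        ((⟪U ω, q⟫ < ⟪U ω, X i⟫ ∧ ⟪U ω, X i⟫ < ⟪U ω, X i₀⟫) ∨
         (⟪U ω, X i₀⟫ < ⟪U ω, X i⟫ ∧ ⟪U ω, X i⟫ < ⟪U ω, q⟫))} : ℝ)}).toReal
      ≤ ((1 / s) * ∑ i ∈ T, ‖q - X i₀‖ / ‖q - X i‖) / (2 * a) := by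
  classical
  obtain ⟨ha0, ha1⟩ := ha
  have hs : 0 < s := hScard ▸ Finset.card_pos.2 ⟨i₀, hi₀S⟩
  have hsR : (0 : ℝ) < s := by exact_mod_cast hs
  set G : Fin m → Set Ω := fun i => {ω | ⟪U ω, X i - q⟫ * ⟪U ω, X i - X i₀⟫ < 0} with hG
  have hGm : ∀ i, MeasurableSet (G i) := fun i => measurableSet_lt (by fun_prop) (by fun_prop)
  have hGp : ∀ i, P.real (G i) ≤ ‖q - X i₀‖ / ‖q - X i‖ / 2 := by
    intro i
    have e : X i - q - (X i - X i₀) = -(q - X i₀) := by abel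
    have := aux_point P U hUmeas hUinv (X i - q) (X i - X i₀)
      (by rw [e, norm_neg, norm_sub_rev (X i) q]; exact hi₀ i)
    rwa [e, norm_neg, norm_sub_rev (X i) q] at this
  set F : Ω → ℝ := fun ω => ∑ i ∈ S, (G i).indicator (fun _ => (1 : ℝ)) ω with hF
  have hFi : ∀ i ∈ S, Integrable ((G i).indicator (fun _ => (1 : ℝ))) P :=
    fun i _ => (integrable_const 1).indicator (hGm i)
  have hFint : Integrable F P := integrable_finsetSum S hFi
  have hFE : ∫ ω, F ω ∂P = ∑ i ∈ S, P.real (G i) := by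
    rw [hF, integral_finsetSum S hFi]
    refine Finset.sum_congr rfl fun i _ => ?_
    rw [integral_indicator_const _ (hGm i)]; simp
  have hmarkov := mul_meas_ge_le_integral_of_nonneg (μ := P) (f := F)
    (Filter.Eventually.of_forall fun ω => Finset.sum_nonneg fun i _ =>
      Set.indicator_nonneg (fun _ _ => zero_le_one) ω) hFint (a * s)
  have hsub : P.real {ω | a * s ≤ (Nat.card {i : Fin m // i ∈ S ∧
        ((⟪U ω, q⟫ < ⟪U ω, X i⟫ ∧ ⟪U ω, X i⟫ < ⟪U ω, X i₀⟫) ∨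
         (⟪U ω, X i₀⟫ < ⟪U ω, X i⟫ ∧ ⟪U ω, X i⟫ < ⟪U ω, q⟫))} : ℝ)}
      ≤ P.real {ω | a * s ≤ F ω} := by
    refine measureReal_mono ?_ (measure_ne_top _ _)
    intro ω hω
    rw [Set.mem_ofPred_eq] at hω ⊢
    refine le_trans hω ?_
    have hFc : F ω = ((S.filter fun i => ω ∈ G i).card : ℝ) := by
      simp only [hF, Set.indicator_apply, Finset.sum_boole]
    rw [hFc, Nat.card_eq_fintype_card, Fintype.card_subtype]
    norm_cast
    apply Finset.card_le_card
    intro i hi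
    simp only [Finset.mem_filter, Finset.mem_univ, true_and] at hi
    refine Finset.mem_filter.2 ⟨hi.1, ?_⟩
    simp only [hG, Set.mem_ofPred_eq, inner_sub_right]
    rcases hi.2 with h | h
    · exact mul_neg_of_pos_of_neg (by linarith) (by linarith)
    · exact mul_neg_of_neg_of_pos (by linarith) (by linarith)
  have hsum : ∑ i ∈ S, ‖q - X i₀‖ / ‖q - X i‖ ≤ ∑ i ∈ T, ‖q - X i₀‖ / ‖q - X i‖ := by
    apply aux_sum S T (hScard.trans hTcard.symm)
    intro i hi j hj
    rcases (norm_nonneg (q - X i₀)).eq_or_lt with h0 | h0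
    · simp [← h0]
    · exact div_le_div_of_nonneg_left h0.le (h0.trans_le (hi₀ i)) (hTclosest i hi j hj)
  have hE : ∑ i ∈ S, P.real (G i) ≤ (∑ i ∈ T, ‖q - X i₀‖ / ‖q - X i‖) / 2 := by
    refine (Finset.sum_le_sum fun i _ => hGp i).trans ?_
    rw [← Finset.sum_div]; linarith
  rw [hFE] at hmarkov
  have has : 0 < a * s := mul_pos ha0 hsR
  have hfin : P.real {ω | a * s ≤ F ω} ≤
      ((1 / s) * ∑ i ∈ T, ‖q - X i₀‖ / ‖q - X i‖) / (2 * a) := by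
    have e : ((1 / (s : ℝ)) * ∑ i ∈ T, ‖q - X i₀‖ / ‖q - X i‖) / (2 * a)
        = ((∑ i ∈ T, ‖q - X i₀‖ / ‖q - X i‖) / 2) / (a * s) := by
      field_simp
    rw [e, le_div_iff₀ has, mul_comm]
    exact hmarkov.trans hE
  exact hsub.trans hfin
end
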